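/- arXiv:1910.08994 — 11 statements merged into one kernel-verified Lean document; each statement's English description precedes it below -/
import Mathlib

section
/- Let ξ : ℝ → ℝ be measurable with 0 < m ≤ ξ(y) ≤ M for all y. Fix η > 0 and a real τ with 0 < τ < τ_e(η) = ∫₀^η dy/ξ(y). Then there exists a unique real z < 0 such that τ = ∫₀^η ξ(y)/(z − ξ(y))² dy. -/
open MeasureTheory intervalIntegral

section SpeedFunction

variable {ξ : ℝ → ℝ} {m M : ℝ}

theorem speed_div_sq_le (hm : 0 < m) (hbd : ∀ y, m ≤ ξ y ∧ ξ y ≤ M) {z : ℝ} (hz : z ≤ 0)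
    (y : ℝ) : ξ y / (z - ξ y) ^ 2 ≤ M / (m - z) ^ 2 := by
  obtain ⟨h1, h2⟩ := hbd y
  have h3 : (m - z) ^ 2 ≤ (z - ξ y) ^ 2 := by nlinarith
  have h4 : 0 < m - z := by linarith
  exact div_le_div₀ (by linarith) h2 (by positivity) h3

theorem norm_speed_div_sq_le (hm : 0 < m) (hbd : ∀ y, m ≤ ξ y ∧ ξ y ≤ M) {z : ℝ} (hz : z ≤ 0)
    (y : ℝ) : ‖ξ y / (z - ξ y) ^ 2‖ ≤ M / m ^ 2 := by
  obtain ⟨h1, h2⟩ := hbd y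
  have hξ : 0 < ξ y := by linarith
  rw [Real.norm_of_nonneg (by positivity)]
  have h3 : m ^ 2 ≤ (z - ξ y) ^ 2 := by nlinarith
  exact div_le_div₀ (by linarith) h2 (by positivity) h3

theorem intervalIntegrable_speed_div_sq (hmeas : Measurable ξ) (hm : 0 < m)
    (hbd : ∀ y, m ≤ ξ y ∧ ξ y ≤ M) {z : ℝ} (hz : z ≤ 0) (a b : ℝ) :
    IntervalIntegrable (fun y => ξ y / (z - ξ y) ^ 2) volume a b := by
  refine (intervalIntegrable_const (c := M / m ^ 2)).mono_fun
    (by fun_prop : Measurable _).aestronglyMeasurable (.of_forall fun y => ?_)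
  exact (norm_speed_div_sq_le hm hbd hz y).trans (Real.le_norm_self _)

theorem continuousOn_integral_speed_div_sq (hmeas : Measurable ξ) (hm : 0 < m)
    (hbd : ∀ y, m ≤ ξ y ∧ ξ y ≤ M) (a b : ℝ) :
    ContinuousOn (fun z => ∫ y in a..b, ξ y / (z - ξ y) ^ 2) (Set.Iic 0) := by
  intro z hz
  refine continuousWithinAt_of_dominated_interval (bound := fun _ => M / m ^ 2)
    (.of_forall fun w => (by fun_prop : Measurable _).aestronglyMeasurable) ?_
    intervalIntegrable_const (.of_forall fun y _ => ?_)
  · filter_upwards [self_mem_nhdsWithin] with w hw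
    exact .of_forall fun y _ => norm_speed_div_sq_le hm hbd hw y
  · have h : (z - ξ y) ^ 2 ≠ 0 :=
      pow_ne_zero 2 (by have := (hbd y).1; have : z ≤ 0 := hz; linarith)
    exact ContinuousAt.continuousWithinAt (by fun_prop (disch := exact h))

theorem strictMonoOn_integral_speed_div_sq (hmeas : Measurable ξ) (hm : 0 < m)
    (hbd : ∀ y, m ≤ ξ y ∧ ξ y ≤ M) {a b : ℝ} (hab : a < b) :
    StrictMonoOn (fun z => ∫ y in a..b, ξ y / (z - ξ y) ^ 2) (Set.Iic 0) := by
  intro z hz w hw hzw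
  have hz' := intervalIntegrable_speed_div_sq hmeas hm hbd hz a b
  have hw' := intervalIntegrable_speed_div_sq hmeas hm hbd hw a b
  have hw0 : w ≤ 0 := hw
  refine sub_pos.1 ?_
  rw [← integral_sub hw' hz']
  refine intervalIntegral_pos_of_pos_on (hw'.sub hz') (fun y _ => sub_pos.2 ?_) hab
  have hξ : 0 < ξ y := hm.trans_le (hbd y).1
  have hpos : 0 < ξ y - w := by linarith
  exact div_lt_div_of_pos_left hξ (by nlinarith) (by nlinarith)

end SpeedFunction

/-- For a measurable speed function `ξ` with `0 < m ≤ ξ y ≤ M`, any `η > 0`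
and `0 < τ < τ_e(η) = ∫₀^η dy/ξ(y)`, there is a unique `z < 0` with
`τ = ∫₀^η ξ(y)/(z − ξ(y))² dy`. -/
theorem stmt_0 (ξ : ℝ → ℝ) (hmeas : Measurable ξ) (m M : ℝ) (hm : 0 < m)
    (hbd : ∀ y, m ≤ ξ y ∧ ξ y ≤ M) (η τ : ℝ) (hη : 0 < η)
    (hτpos : 0 < τ) (hτ : τ < ∫ y in (0:ℝ)..η, 1 / ξ y) :
    ∃! z : ℝ, z < 0 ∧ τ = ∫ y in (0:ℝ)..η, ξ y / (z - ξ y) ^ 2 := by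
  have hmono := strictMonoOn_integral_speed_div_sq hmeas hm hbd hη
  have hcont := continuousOn_integral_speed_div_sq hmeas hm hbd 0 η
  have hM : 0 < M := hm.trans_le ((hbd 0).1.trans (hbd 0).2)
  have hzero : ∫ y in (0:ℝ)..η, ξ y / (0 - ξ y) ^ 2 = ∫ y in (0:ℝ)..η, 1 / ξ y := by
    refine integral_congr fun y _ => ?_
    have hξ : ξ y ≠ 0 := (hm.trans_le (hbd y).1).ne'
    field_simp
    simp
  set c := 1 + η * M / τ with hc
  have hquot : 0 < η * M / τ := by positivity
  have hlow : ∫ y in (0:ℝ)..η, ξ y / (-c - ξ y) ^ 2 < τ := by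
    calc ∫ y in (0:ℝ)..η, ξ y / (-c - ξ y) ^ 2
        ≤ ∫ _ in (0:ℝ)..η, M / (m - -c) ^ 2 :=
          integral_mono hη.le
            (intervalIntegrable_speed_div_sq hmeas hm hbd (by linarith) 0 η)
            intervalIntegrable_const (speed_div_sq_le hm hbd (by linarith))
      _ = η * M / (m + c) ^ 2 := by
          rw [intervalIntegral.integral_const, smul_eq_mul, sub_neg_eq_add, sub_zero, mul_div_assoc]
      _ < τ := by
          have h : η * M / τ < (m + c) ^ 2 := by nlinarith
          rw [div_lt_iff₀ (by nlinarith)]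
          rwa [div_lt_iff₀' hτpos] at h
  obtain ⟨z, hz, hzτ⟩ := intermediate_value_Ioo (a := -c) (b := 0) (by linarith)
    (hcont.mono fun _ hx => hx.2) ⟨hlow, hτ.trans_eq hzero.symm⟩
  exact ⟨z, ⟨hz.2, hzτ.symm⟩, fun w hw =>
    hmono.injOn hw.1.le hz.2.le (hw.2.symm.trans hzτ.symm)⟩
end

section
/- Let ξ : ℝ → ℝ be measurable with 0 < m ≤ ξ(y) ≤ M for all y. Fix η > 0 and 0 < τ < τ_e(η), and let 𝔷 < 0 be the unique negative real satisfying τ = ∫₀^η ξ(y)/(𝔷 − ξ(y))² dy. Define F(z, η) := ∫₀^η z/(ξ(y) − z) dy for z < 0. Then for every z < 0 with z ≠ 𝔷 one has τ·z − F(z, η) < τ·𝔷 − F(𝔷, η), and the maximal value satisfies τ·𝔷 − F(𝔷, η) = ∫₀^η 𝔷²/(𝔷 − ξ(y))² dy. -/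
open MeasureTheory intervalIntegral

theorem intervalIntegrable_of_measurable_of_abs_le {f : ℝ → ℝ} (hf : Measurable f) {C : ℝ}
    (hC : ∀ y, |f y| ≤ C) (a b : ℝ) : IntervalIntegrable f volume a b :=
  (intervalIntegrable_const (c := C)).mono_fun hf.aestronglyMeasurable
    (Filter.Eventually.of_forall fun y => (hC y).trans (le_abs_self C))

theorem intervalIntegrable_div_sub {ξ : ℝ → ℝ} (hξ : Measurable ξ) {m : ℝ} (hm : 0 < m)
    (hmξ : ∀ y, m ≤ ξ y) {z : ℝ} (hz : z < 0) (a b : ℝ) :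
    IntervalIntegrable (fun y => z / (ξ y - z)) volume a b := by
  refine intervalIntegrable_of_measurable_of_abs_le (C := 1)
    (by fun_prop) (fun y => ?_) a b
  have hy := hmξ y
  rw [abs_div, abs_of_neg hz, abs_of_pos (by linarith), div_le_one (by linarith)]
  linarith

theorem intervalIntegrable_div_sub_sq {ξ : ℝ → ℝ} (hξ : Measurable ξ) {m : ℝ} (hm : 0 < m)
    (hmξ : ∀ y, m ≤ ξ y) {z : ℝ} (hz : z < 0) (a b : ℝ) :
    IntervalIntegrable (fun y => ξ y / (z - ξ y) ^ 2) volume a b := by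
  refine intervalIntegrable_of_measurable_of_abs_le (C := 1 / m)
    (by fun_prop) (fun y => ?_) a b
  have hy := hmξ y
  have hpos : 0 < ξ y := hm.trans_le hy
  have hsq : 0 < (z - ξ y) ^ 2 := sq_pos_of_neg (by linarith)
  rw [abs_of_nonneg (by positivity), div_le_div_iff₀ hsq hm]
  nlinarith [mul_pos (neg_pos.2 hz) hpos, sq_nonneg z]

/-- The gap between `z ↦ z / (x - z)` and its tangent line at `w`. -/
theorem div_sub_gap {x z w : ℝ} (hz : x - z ≠ 0) (hw : x - w ≠ 0) :
    z / (x - z) - w / (x - w) - (z - w) * (x / (w - x) ^ 2) =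
      x * (z - w) ^ 2 / ((x - z) * (x - w) ^ 2) := by
  rw [← neg_sub x w, neg_sq]
  field_simp
  ring

/-- Legendre duality: with `𝔷 < 0` the unique negative root of
`τ = ∫₀^η ξ(y)/(𝔷 − ξ(y))² dy` and `F(z,η) = ∫₀^η z/(ξ(y) − z) dy`, the function
`z ↦ τz − F(z,η)` on `(−∞,0)` attains its strict maximum at `z = 𝔷`, and the maximal
value equals `∫₀^η 𝔷²/(𝔷 − ξ(y))² dy`. -/
theorem stmt_2 (ξ : ℝ → ℝ) (hmeas : Measurable ξ) (m M : ℝ) (hm : 0 < m)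
    (hbd : ∀ y, m ≤ ξ y ∧ ξ y ≤ M) (η τ : ℝ) (hη : 0 < η) (hτpos : 0 < τ)
    (hτ : τ < ∫ y in (0:ℝ)..η, 1 / ξ y)
    (z₀ : ℝ) (hz₀ : z₀ < 0)
    (hroot : τ = ∫ y in (0:ℝ)..η, ξ y / (z₀ - ξ y) ^ 2) :
    (∀ z : ℝ, z < 0 → z ≠ z₀ →
      τ * z - (∫ y in (0:ℝ)..η, z / (ξ y - z)) <
        τ * z₀ - ∫ y in (0:ℝ)..η, z₀ / (ξ y - z₀)) ∧
    τ * z₀ - (∫ y in (0:ℝ)..η, z₀ / (ξ y - z₀)) =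
      ∫ y in (0:ℝ)..η, z₀ ^ 2 / (z₀ - ξ y) ^ 2 := by
  have hmξ y := (hbd y).1
  have hpos y : 0 < ξ y := hm.trans_le (hmξ y)
  have hF {z : ℝ} (hz : z < 0) := intervalIntegrable_div_sub hmeas hm hmξ hz 0 η
  have hT := intervalIntegrable_div_sub_sq hmeas hm hmξ hz₀ 0 η
  constructor
  · intro z hz hne
    have hgap : 0 < ∫ y in (0:ℝ)..η,
        (z / (ξ y - z) - z₀ / (ξ y - z₀) - (z - z₀) * (ξ y / (z₀ - ξ y) ^ 2)) := by
      refine intervalIntegral_pos_of_pos (((hF hz).sub (hF hz₀)).sub (hT.const_mul _))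
        (fun y => ?_) hη
      have hy := hpos y
      have h₁ : 0 < ξ y - z := by linarith
      have h₂ : 0 < ξ y - z₀ := by linarith
      have h₃ : z - z₀ ≠ 0 := sub_ne_zero.2 hne
      rw [div_sub_gap h₁.ne' h₂.ne']
      positivity
    rw [integral_sub ((hF hz).sub (hF hz₀)) (hT.const_mul _), integral_sub (hF hz) (hF hz₀),
      intervalIntegral.integral_const_mul, ← hroot] at hgap
    linarith
  · rw [hroot, ← intervalIntegral.integral_mul_const, ← integral_sub (hT.mul_const _) (hF hz₀)]
    refine integral_congr fun y _ => ?_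
    have h : ξ y - z₀ ≠ 0 := by linarith [hpos y]
    rw [← neg_sub (ξ y) z₀, neg_sq]
    field_simp
    ring
end

section
/- Let ξ : ℝ → ℝ be measurable with 0 < m ≤ ξ(y) ≤ M for all y, and fix τ > 0. Let S := {η > 0 : τ < τ_e(η)} and suppose Z : S → ℝ satisfies Z(η) < 0 and τ = ∫₀^η ξ(y)/(Z(η) − ξ(y))² dy for every η ∈ S. Then Z is continuous on S, and consequently the function η ↦ ∫₀^η Z(η)²/(Z(η) − ξ(y))² dy is continuous on S. -/
open MeasureTheory intervalIntegral
open Filter Topology Set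

section SpeedKernel

variable {ξ : ℝ → ℝ} {m M : ℝ}

lemma speedKernel_intervalIntegrable (hmeas : Measurable ξ) (hm : 0 < m)
    (hbd : ∀ y, m ≤ ξ y ∧ ξ y ≤ M) {z : ℝ} (hz : z < 0) (a b : ℝ) :
    IntervalIntegrable (fun y => ξ y / (z - ξ y) ^ 2) volume a b := by
  refine (intervalIntegrable_const (c := M / m ^ 2)).mono_fun
    (hmeas.div (by fun_prop)).aestronglyMeasurable (ae_of_all _ fun y => ?_)
  obtain ⟨h₁, h₂⟩ := hbd y
  have hξ : 0 < ξ y := hm.trans_le h₁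
  have hM : 0 < M := hξ.trans_le h₂
  have hsq : m ^ 2 ≤ (z - ξ y) ^ 2 := by nlinarith
  simp only [Real.norm_eq_abs]
  rw [abs_of_nonneg (by positivity), abs_of_nonneg (by positivity)]
  gcongr

lemma speedKernel_lt (hm : 0 < m) (hbd : ∀ y, m ≤ ξ y ∧ ξ y ≤ M) {z w : ℝ} (hzw : z < w)
    (hw : w < 0) (y : ℝ) : ξ y / (z - ξ y) ^ 2 < ξ y / (w - ξ y) ^ 2 := by
  have hξ : 0 < ξ y := hm.trans_le (hbd y).1
  have hpos : 0 < (w - ξ y) ^ 2 := by nlinarith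
  exact div_lt_div_of_pos_left hξ hpos (by nlinarith)

/-- The travel time `∫₀^η ξ / (z - ξ)²` is strictly increasing in `z < 0`. -/
lemma integral_speedKernel_strictMonoOn (hmeas : Measurable ξ) (hm : 0 < m)
    (hbd : ∀ y, m ≤ ξ y ∧ ξ y ≤ M) {η : ℝ} (hη : 0 < η) :
    StrictMonoOn (fun z => ∫ y in (0:ℝ)..η, ξ y / (z - ξ y) ^ 2) (Iio 0) := by
  intro z hz w hw hzw
  have iz := speedKernel_intervalIntegrable hmeas hm hbd hz 0 η
  have iw := speedKernel_intervalIntegrable hmeas hm hbd hw 0 η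
  have h := intervalIntegral_pos_of_pos_on (iw.sub iz)
    (fun y _ => sub_pos.2 (speedKernel_lt hm hbd hzw hw y)) hη
  rw [integral_sub iw iz] at h
  exact sub_pos.1 h

/-- Joint continuity of `(z, η) ↦ ∫₀^η f z (ξ y) / (z - ξ y)² dy` at points with `z < 0`. -/
lemma continuousAt_integral_div_sq (hmeas : Measurable ξ) (hm : 0 < m)
    (hbd : ∀ y, m ≤ ξ y ∧ ξ y ≤ M) {f : ℝ → ℝ → ℝ} (hf : Continuous (Function.uncurry f))
    {C : ℝ} {z₀ η₀ : ℝ} (hz₀ : z₀ < 0)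
    (hC : ∀ᶠ z in 𝓝 z₀, ∀ y, |f z (ξ y)| ≤ C) :
    ContinuousAt (fun p : ℝ × ℝ => ∫ y in (0:ℝ)..p.2, f p.1 (ξ y) / (p.1 - ξ y) ^ 2)
      (z₀, η₀) := by
  refine continuousAt_parametric_primitive_of_dominated
    (F := fun z y => f z (ξ y) / (z - ξ y) ^ 2) (fun _ => C / m ^ 2)
    (min 0 η₀ - 1) (max 0 η₀ + 1) (fun z => ?_) ?_ intervalIntegrable_const
    (ae_of_all _ fun y => ?_) ?_ ?_ (by simp)
  · have h : Measurable fun y => f z (ξ y) :=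
      (hf.comp (Continuous.prodMk_right z)).measurable.comp hmeas
    exact (h.div (by fun_prop)).aestronglyMeasurable
  · filter_upwards [hC, Iio_mem_nhds hz₀] with z hz hz'
    refine ae_of_all _ fun y => ?_
    have hz'' : z < 0 := hz'
    have hξ := (hbd y).1
    have hsq : m ^ 2 ≤ (z - ξ y) ^ 2 := by nlinarith
    have hC0 : 0 ≤ C := (abs_nonneg _).trans (hz y)
    rw [Real.norm_eq_abs, abs_div, abs_of_nonneg (sq_nonneg (z - ξ y))]
    gcongr
    exact hz y
  · have hξ := (hbd y).1
    have hne : (z₀ - ξ y) ^ 2 ≠ 0 := pow_ne_zero 2 (by linarith)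
    have h : Continuous fun z => f z (ξ y) := hf.comp (Continuous.prodMk_left (ξ y))
    exact h.continuousAt.div (by fun_prop) hne
  · constructor
    · linarith [min_le_left 0 η₀]
    · linarith [le_max_left 0 η₀]
  · constructor
    · linarith [min_le_right 0 η₀]
    · linarith [le_max_right 0 η₀]

lemma continuousAt_integral_speedKernel (hmeas : Measurable ξ) (hm : 0 < m)
    (hbd : ∀ y, m ≤ ξ y ∧ ξ y ≤ M) {z η₀ : ℝ} (hz : z < 0) :
    ContinuousAt (fun η => ∫ y in (0:ℝ)..η, ξ y / (z - ξ y) ^ 2) η₀ := by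
  have h := continuousAt_integral_div_sq (η₀ := η₀) hmeas hm hbd (f := fun _ x => x)
    continuous_snd hz (C := M) (Eventually.of_forall fun _ y => by
      rw [abs_of_pos (hm.trans_le (hbd y).1)]
      exact (hbd y).2)
  exact h.comp (f := fun η : ℝ => (z, η)) (by fun_prop)

end SpeedKernel

/-- For fixed `τ > 0`, on `S = {η > 0 : τ < τ_e(η)}` the negative root
`Z(η)` of `τ = ∫₀^η ξ(y)/(z − ξ(y))² dy` is continuous, and consequently
`η ↦ ∫₀^η Z(η)²/(Z(η) − ξ(y))² dy` is continuous on `S`. -/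
theorem stmt_3 (ξ : ℝ → ℝ) (hmeas : Measurable ξ) (m M : ℝ) (hm : 0 < m)
    (hbd : ∀ y, m ≤ ξ y ∧ ξ y ≤ M) (τ : ℝ) (hτ : 0 < τ)
    (S : Set ℝ) (hS : S = {η : ℝ | 0 < η ∧ τ < ∫ y in (0:ℝ)..η, 1 / ξ y})
    (Z : ℝ → ℝ)
    (hZ : ∀ η ∈ S, Z η < 0 ∧ τ = ∫ y in (0:ℝ)..η, ξ y / (Z η - ξ y) ^ 2) :
    ContinuousOn Z S ∧
    ContinuousOn (fun η : ℝ => ∫ y in (0:ℝ)..η, (Z η) ^ 2 / (Z η - ξ y) ^ 2) S := by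
  have hpos : ∀ η ∈ S, 0 < η := by
    rw [hS]
    exact fun η h => h.1
  have hcont : ContinuousOn Z S := by
    intro η₀ h₀
    obtain ⟨hz₀, hτ₀⟩ := hZ η₀ h₀
    have hmono := integral_speedKernel_strictMonoOn hmeas hm hbd (hpos η₀ h₀)
    refine tendsto_order.2 ⟨fun a ha => ?_, fun b hb => ?_⟩
    · have ha0 : a < 0 := ha.trans hz₀
      have hlt := hmono ha0 hz₀ ha
      simp only [← hτ₀] at hlt
      filter_upwards [mem_nhdsWithin_of_mem_nhds
        ((continuousAt_integral_speedKernel hmeas hm hbd ha0).eventually_lt_const hlt),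
        self_mem_nhdsWithin] with η hη hηS
      obtain ⟨hz, hτη⟩ := hZ η hηS
      rw [hτη] at hη
      exact (integral_speedKernel_strictMonoOn hmeas hm hbd (hpos η hηS)).lt_iff_lt ha0 hz |>.1 hη
    · obtain ⟨c, hc, hcb⟩ := exists_between (lt_min hb hz₀)
      have hc0 : c < 0 := hcb.trans_le (min_le_right _ _)
      have hlt := hmono hz₀ hc0 hc
      simp only [← hτ₀] at hlt
      filter_upwards [mem_nhdsWithin_of_mem_nhds
        ((continuousAt_integral_speedKernel hmeas hm hbd hc0).eventually_const_lt hlt),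
        self_mem_nhdsWithin] with η hη hηS
      obtain ⟨hz, hτη⟩ := hZ η hηS
      rw [hτη] at hη
      have h := (integral_speedKernel_strictMonoOn hmeas hm hbd
        (hpos η hηS)).lt_iff_lt hz hc0 |>.1 hη
      exact h.trans (hcb.trans_le (min_le_left _ _))
  refine ⟨hcont, fun η₀ h₀ => ?_⟩
  have hz₀ := (hZ η₀ h₀).1
  have hsq : ∀ᶠ z in 𝓝 (Z η₀), ∀ y, |(fun z _ : ℝ => z ^ 2) z (ξ y)| ≤ Z η₀ ^ 2 + 1 := by
    have h : ContinuousAt (fun z : ℝ => z ^ 2) (Z η₀) := by fun_prop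
    filter_upwards [h.eventually_lt_const (lt_add_one _)] with z hz y
    rw [abs_of_nonneg (sq_nonneg z)]
    exact hz.le
  have h := continuousAt_integral_div_sq (η₀ := η₀) hmeas hm hbd
    (f := fun z _ => z ^ 2) (by fun_prop) hz₀ hsq
  exact h.comp_continuousWithinAt (f := fun η => (Z η, η))
    ((hcont η₀ h₀).prodMk continuousWithinAt_id)
end

section
/- Let ξ : ℝ → ℝ be measurable with 0 < m ≤ ξ(y) ≤ M for all y. Fix η > 0 and τ₀ > 0, let J be an open interval containing τ₀, and let W : J → ℝ satisfy W(τ) < 0 for all τ ∈ J and τ = ∫₀^η ξ(y)/(W(τ) − ξ(y))² dy for all τ ∈ J. If W is differentiable at τ₀, then W′(τ₀) · ∫₀^η 2ξ(y)/(W(τ₀) − ξ(y))³ dy = −1. -/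
open MeasureTheory intervalIntegral

/-- For a measurable speed function `ξ` with values in `[m, M]`, `0 < m`, the integral
`∫₀^η ξ(y)/(w − ξ(y))² dy` may be differentiated under the integral sign at `w < 0`. -/
theorem hasDerivAt_integral_div_sub_sq {ξ : ℝ → ℝ} (hmeas : Measurable ξ) {m M : ℝ} (hm : 0 < m)
    (hbd : ∀ y, m ≤ ξ y ∧ ξ y ≤ M) (η : ℝ) {w : ℝ} (hw : w < 0) :
    HasDerivAt (fun z => ∫ y in (0:ℝ)..η, ξ y / (z - ξ y) ^ 2)
      (-∫ y in (0:ℝ)..η, 2 * ξ y / (w - ξ y) ^ 3) w := by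
  have hgap : ∀ z < 0, ∀ y, m ≤ |z - ξ y| := fun z hz y => by
    rw [abs_sub_comm]
    exact le_trans (by linarith [(hbd y).1]) (le_abs_self _)
  have habs : ∀ y, |ξ y| ≤ M := fun y =>
    abs_le.2 ⟨by linarith [(hbd y).1, (hbd y).2], (hbd y).2⟩
  have hM : 0 ≤ M := (abs_nonneg _).trans (habs 0)
  rw [← intervalIntegral.integral_neg]
  refine (hasDerivAt_integral_of_dominated_loc_of_deriv_le
    (F := fun z y => ξ y / (z - ξ y) ^ 2) (F' := fun z y => -(2 * ξ y / (z - ξ y) ^ 3))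
    (s := Set.Iio 0) (bound := fun _ => 2 * M / m ^ 3) (Iio_mem_nhds hw)
    (.of_forall fun z => ?_) ?_ ?_ ?_ intervalIntegrable_const ?_).2
  · exact (by fun_prop : Measurable fun y => ξ y / (z - ξ y) ^ 2).aestronglyMeasurable
  · refine (intervalIntegrable_const (c := M / m ^ 2)).mono_fun
      (by fun_prop : Measurable fun y => ξ y / (w - ξ y) ^ 2).aestronglyMeasurable
      (.of_forall fun y => ?_)
    have hy := hgap w hw y
    refine le_trans ?_ (le_abs_self _)
    simp only [Real.norm_eq_abs, abs_div, abs_pow]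
    gcongr
    exact habs y
  · exact (by fun_prop : Measurable fun y => -(2 * ξ y / (w - ξ y) ^ 3)).aestronglyMeasurable
  · refine .of_forall fun y _ z hz => ?_
    have hy := hgap z hz y
    simp only [Real.norm_eq_abs, abs_neg, abs_div, abs_pow, abs_mul, abs_two]
    gcongr
    exact habs y
  · refine .of_forall fun y _ z hz => ?_
    have hne : z - ξ y ≠ 0 := abs_pos.1 (hm.trans_le (hgap z hz y))
    refine ((hasDerivAt_const z (ξ y)).div (((hasDerivAt_id' z).sub_const (ξ y)).pow 2)
      (pow_ne_zero 2 hne)).congr_deriv ?_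
    simp only [Pi.pow_apply]
    field_simp
    ring

/-- implicit differentiation in `τ`: if `W(τ) < 0` solves
`τ = ∫₀^η ξ(y)/(W(τ) − ξ(y))² dy` on an open interval around `τ₀` and `W` is
differentiable at `τ₀`, then `W′(τ₀) · ∫₀^η 2ξ(y)/(W(τ₀) − ξ(y))³ dy = −1`. -/
theorem stmt_8 (ξ : ℝ → ℝ) (hmeas : Measurable ξ) (m M : ℝ) (hm : 0 < m)
    (hbd : ∀ y, m ≤ ξ y ∧ ξ y ≤ M) (η : ℝ) (hη : 0 < η)
    (τ₀ a b : ℝ) (hτ₀ : 0 < τ₀) (hmem : τ₀ ∈ Set.Ioo a b)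
    (W : ℝ → ℝ)
    (hWneg : ∀ τ ∈ Set.Ioo a b, W τ < 0)
    (hW : ∀ τ ∈ Set.Ioo a b, τ = ∫ y in (0:ℝ)..η, ξ y / (W τ - ξ y) ^ 2)
    (hdiff : DifferentiableAt ℝ W τ₀) :
    deriv W τ₀ * (∫ y in (0:ℝ)..η, 2 * ξ y / (W τ₀ - ξ y) ^ 3) = -1 := by
  have hcomp := (hasDerivAt_integral_div_sub_sq hmeas hm hbd η (hWneg τ₀ hmem)).comp τ₀
    hdiff.hasDerivAt
  have hid : HasDerivAt (fun τ : ℝ => τ) _ τ₀ := hcomp.congr_of_eventuallyEq <| by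
    filter_upwards [Ioo_mem_nhds hmem.1 hmem.2] with τ hτ using hW τ hτ
  linarith [hid.unique (hasDerivAt_id' τ₀)]
end

section
/- Let ξ : ℝ → ℝ be continuous with 0 < m ≤ ξ(y) ≤ M for all y. Fix τ > 0 and η₀ > 0, let I be an open interval containing η₀, and let Z : I → ℝ be differentiable at η₀ with Z(η) < 0 for all η ∈ I and τ = ∫₀^η ξ(y)/(Z(η) − ξ(y))² dy for all η ∈ I. Then the function H(η) := ∫₀^η Z(η)²/(Z(η) − ξ(y))² dy is differentiable at η₀ with H′(η₀) = Z(η₀)/(Z(η₀) − ξ(η₀)). -/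
open MeasureTheory intervalIntegral

/-- The tangent-type identity for `z ↦ z / (z - x)`, with an explicit quadratic remainder. -/
lemma sq_div_sub_sq_eq {z w x : ℝ} (hz : z - x ≠ 0) (hw : w - x ≠ 0) :
    z ^ 2 / (z - x) ^ 2 =
      w / (w - x) + w * (x / (z - x) ^ 2) - (z - w) ^ 2 * (x / ((z - x) ^ 2 * (w - x))) := by
  field_simp
  ring

lemma norm_div_sq_mul_sub_le {z w x m : ℝ} (hm : 0 < m) (hx : m ≤ x) (hz : z < 0) (hw : w < 0) :
    ‖x / ((z - x) ^ 2 * (w - x))‖ ≤ (m ^ 2)⁻¹ := by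
  have hx0 : 0 < x := hm.trans_le hx
  rw [Real.norm_eq_abs, abs_div, abs_mul, abs_of_pos hx0, abs_of_nonneg (sq_nonneg (z - x)),
    abs_of_neg (by linarith : w - x < 0), inv_eq_one_div, div_le_div_iff₀ _ (by positivity)]
  · have h : m ^ 2 ≤ (z - x) ^ 2 := by nlinarith
    calc x * m ^ 2 ≤ -(w - x) * (z - x) ^ 2 :=
          mul_le_mul (by linarith) h (by positivity) (by linarith)
      _ = 1 * ((z - x) ^ 2 * -(w - x)) := by ring
  · exact mul_pos (by nlinarith) (by linarith)

/-- if `Z(η) < 0` solves `τ = ∫₀^η ξ(y)/(Z(η) − ξ(y))² dy` on an open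
interval around `η₀` and `Z` is differentiable at `η₀`, then the limiting height
function `H(η) = ∫₀^η Z(η)²/(Z(η) − ξ(y))² dy` is differentiable at `η₀` with
derivative (= limiting density) `Z(η₀)/(Z(η₀) − ξ(η₀))`. -/
theorem stmt_9 (ξ : ℝ → ℝ) (hcont : Continuous ξ) (m M : ℝ) (hm : 0 < m)
    (hbd : ∀ y, m ≤ ξ y ∧ ξ y ≤ M) (τ : ℝ) (hτ : 0 < τ)
    (η₀ a b : ℝ) (hη₀ : 0 < η₀) (hmem : η₀ ∈ Set.Ioo a b)
    (Z : ℝ → ℝ) (hdiff : DifferentiableAt ℝ Z η₀)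
    (hZneg : ∀ η ∈ Set.Ioo a b, Z η < 0)
    (hZ : ∀ η ∈ Set.Ioo a b, τ = ∫ y in (0:ℝ)..η, ξ y / (Z η - ξ y) ^ 2) :
    HasDerivAt (fun η : ℝ => ∫ y in (0:ℝ)..η, (Z η) ^ 2 / (Z η - ξ y) ^ 2)
      (Z η₀ / (Z η₀ - ξ η₀)) η₀ := by
  have hne : ∀ {z : ℝ}, z < 0 → ∀ y, z - ξ y ≠ 0 := fun hz y => by
    have := (hbd y).1
    linarith
  have hw := hZneg η₀ hmem
  set w := Z η₀
  have hcw : Continuous fun y => w / (w - ξ y) :=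
    continuous_const.div (continuous_const.sub hcont) (hne hw)
  set r : ℝ → ℝ := fun η => ∫ y in (0:ℝ)..η, ξ y / ((Z η - ξ y) ^ 2 * (w - ξ y))
  have heq : ∀ η ∈ Set.Ioo a b, (∫ y in (0:ℝ)..η, (Z η) ^ 2 / (Z η - ξ y) ^ 2) =
      (∫ y in (0:ℝ)..η, w / (w - ξ y)) + w * τ - (Z η - w) ^ 2 * r η := by
    intro η hη
    have hz := hZneg η hη
    have h₁ : Continuous fun y => ξ y / (Z η - ξ y) ^ 2 :=
      hcont.div ((continuous_const.sub hcont).pow 2) fun y => pow_ne_zero 2 (hne hz y)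
    have h₂ : Continuous fun y => ξ y / ((Z η - ξ y) ^ 2 * (w - ξ y)) :=
      hcont.div (((continuous_const.sub hcont).pow 2).mul (continuous_const.sub hcont))
        fun y => mul_ne_zero (pow_ne_zero 2 (hne hz y)) (hne hw y)
    simp_rw [fun y => sq_div_sub_sq_eq (hne hz y) (hne hw y)]
    have h₃ : Continuous fun y => w * (ξ y / (Z η - ξ y) ^ 2) := continuous_const.mul h₁
    have h₄ : Continuous fun y => w / (w - ξ y) + w * (ξ y / (Z η - ξ y) ^ 2) := hcw.add h₃
    have h₅ : Continuous fun y => (Z η - w) ^ 2 * (ξ y / ((Z η - ξ y) ^ 2 * (w - ξ y))) :=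
      continuous_const.mul h₂
    rw [intervalIntegral.integral_sub (h₄.intervalIntegrable _ _) (h₅.intervalIntegrable _ _),
      intervalIntegral.integral_add (hcw.intervalIntegrable _ _) (h₃.intervalIntegrable _ _),
      intervalIntegral.integral_const_mul, intervalIntegral.integral_const_mul, ← hZ η hη]
  have hmem_nhds : Set.Ioo a b ∈ nhds η₀ := isOpen_Ioo.mem_nhds hmem
  have hr_bdd : r =O[nhds η₀] fun _ => (1 : ℝ) := by
    have hid : (fun η : ℝ => η) =O[nhds η₀] fun _ => (1 : ℝ) := continuousAt_id.isBigO_one ℝ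
    refine Asymptotics.IsBigO.trans (.of_bound (m ^ 2)⁻¹ ?_) hid
    filter_upwards [hmem_nhds] with η hη
    simpa using intervalIntegral.norm_integral_le_of_norm_le_const (a := 0) (b := η)
      fun y _ => norm_div_sq_mul_sub_le hm (hbd y).1 (hZneg η hη) hw
  have hrem : HasDerivAt (fun η => (Z η - w) ^ 2 * r η) 0 η₀ := by
    have h : (fun η => (Z η - w) ^ 2 * r η) =O[nhds η₀] fun η => ‖η - η₀‖ ^ 2 := by
      simpa using (hdiff.isBigO_sub.norm_right.pow 2).mul hr_bdd
    simpa using (h.hasFDerivAt one_lt_two).hasDerivAt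
  have hmain : HasDerivAt (fun η => ∫ y in (0:ℝ)..η, w / (w - ξ y)) (w / (w - ξ η₀)) η₀ :=
    hcw.integral_hasStrictDerivAt 0 η₀ |>.hasDerivAt
  have h := (hmain.add_const (w * τ)).sub hrem
  rw [sub_zero] at h
  exact h.congr_of_eventuallyEq (Filter.eventually_of_mem hmem_nhds heq)
end

section
/- Let ξ : ℝ → ℝ be continuous with 0 < m ≤ ξ(y) ≤ M for all y. Let U ⊆ (0,∞) × (0,∞) be open, (τ₀, η₀) ∈ U, and let 𝔷 : U → ℝ satisfy 𝔷(τ, η) < 0 and τ = ∫₀^η ξ(y)/(𝔷(τ, η) − ξ(y))² dy for all (τ, η) ∈ U. Assume that the partial derivatives ∂_τ 𝔷 and ∂_η 𝔷 exist at (τ₀, η₀). Define ρ(τ, η) := 𝔷(τ, η)/(𝔷(τ, η) − ξ(η)). Then the density ρ satisfies the hydrodynamic equation at (τ₀, η₀): the partial derivative in τ of ρ at (τ₀, η₀), plus the partial derivative in η of the flux η ↦ ξ(η) ρ(τ₀, η)/(1 − ρ(τ₀, η)) at η₀, equals zero. -/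
open MeasureTheory intervalIntegral

/-- Differentiation under the integral sign of `∫ ξ / (w - ξ)²` in the parameter `w < 0`. -/
theorem differentiableAt_integral_div_sub_sq {ξ : ℝ → ℝ} (hcont : Continuous ξ) {m M : ℝ}
    (hm : 0 < m) (hbd : ∀ y, m ≤ ξ y ∧ ξ y ≤ M) (a b : ℝ) {w₀ : ℝ} (hw₀ : w₀ < 0) :
    DifferentiableAt ℝ (fun w : ℝ => ∫ y in a..b, ξ y / (w - ξ y) ^ 2) w₀ := by
  have hne : ∀ w < 0, ∀ y, w - ξ y ≠ 0 := fun w hw y => by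
    have := (hbd y).1
    linarith
  have hcts : ∀ w < 0, Continuous fun y => ξ y / (w - ξ y) ^ 2 := fun w hw =>
    hcont.div ((continuous_const.sub hcont).pow 2) fun y => pow_ne_zero 2 (hne w hw y)
  refine (intervalIntegral.hasDerivAt_integral_of_dominated_loc_of_deriv_le
    (F' := fun w y => -2 * ξ y / (w - ξ y) ^ 3) (bound := fun _ => 2 * M / m ^ 3)
    (Iio_mem_nhds hw₀) ?_ ((hcts w₀ hw₀).intervalIntegrable _ _) ?_ ?_ ?_ ?_).2.differentiableAt
  · filter_upwards [Iio_mem_nhds hw₀] with w hw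
    exact (hcts w hw).aestronglyMeasurable
  · exact ((continuous_const.mul hcont).div ((continuous_const.sub hcont).pow 3)
      fun y => pow_ne_zero 3 (hne w₀ hw₀ y)).aestronglyMeasurable
  · refine Filter.Eventually.of_forall fun y _ w hw => ?_
    have hw' : w < 0 := hw
    obtain ⟨h1, h2⟩ := hbd y
    rw [Real.norm_eq_abs, abs_div, abs_mul, abs_pow, abs_of_pos (hm.trans_le h1),
      abs_of_neg (show w - ξ y < 0 by linarith)]
    norm_num
    have h3 : m ≤ ξ y - w := by linarith
    have h4 : 0 ≤ M := by linarith
    gcongr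
  · exact intervalIntegrable_const
  · refine Filter.Eventually.of_forall fun y _ w hw => ?_
    have h := hne w hw y
    have hd : HasDerivAt (fun v => (v - ξ y) ^ 2) (2 * (w - ξ y)) w := by
      exact (((hasDerivAt_id w).sub_const (ξ y)).pow 2).congr_deriv (by simp)
    refine ((hasDerivAt_const w (ξ y)).div hd (pow_ne_zero 2 h)).congr_deriv ?_
    field_simp
    ring

/-- The derivative at `a` of `x ↦ ∫ y in a..x, f x y` is `f a a`. -/
theorem hasDerivAt_integral_diagonal {f : ℝ → ℝ → ℝ} {a : ℝ}
    (hf : ContinuousAt (Function.uncurry f) (a, a))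
    (hint : ∀ᶠ x in nhds a, IntervalIntegrable (f x) volume a x) :
    HasDerivAt (fun x => ∫ y in a..x, f x y) (f a a) a := by
  rw [hasDerivAt_iff_isLittleO, Asymptotics.isLittleO_iff]
  intro c hc
  obtain ⟨δ, hδ, hball⟩ := Metric.continuousAt_iff.1 hf c hc
  filter_upwards [hint, Metric.ball_mem_nhds a hδ] with x hx hxδ
  have hxδ' : |x - a| < δ := hxδ
  have key : (∫ y in a..x, f x y) - (∫ y in a..a, f a y) - (x - a) • f a a
      = ∫ y in a..x, (f x y - f a a) := by
    rw [intervalIntegral.integral_sub hx intervalIntegrable_const]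
    simp
  rw [key]
  refine intervalIntegral.norm_integral_le_of_norm_le_const fun y hy => ?_
  have hy' : |y - a| ≤ |x - a| :=
    Set.abs_sub_left_of_mem_uIcc (Set.uIoc_subset_uIcc hy)
  have hd : dist (x, y) (a, a) < δ := by
    rw [Prod.dist_eq]
    exact max_lt hxδ' (hy'.trans_lt hxδ')
  exact (hball hd).le

/-- if `𝔷(τ,η) < 0` solves `τ = ∫₀^η ξ(y)/(𝔷(τ,η) − ξ(y))² dy` on an open
set `U ⊆ (0,∞) × (0,∞)` and has both partial derivatives at `(τ₀,η₀) ∈ U`, then the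
density `ρ(τ,η) = 𝔷(τ,η)/(𝔷(τ,η) − ξ(η))` satisfies the hydrodynamic equation
`∂_τ ρ + ∂_η (ξ(η) ρ/(1 − ρ)) = 0` at `(τ₀,η₀)`. -/
theorem stmt_10 (ξ : ℝ → ℝ) (hcont : Continuous ξ) (m M : ℝ) (hm : 0 < m)
    (hbd : ∀ y, m ≤ ξ y ∧ ξ y ≤ M)
    (U : Set (ℝ × ℝ)) (hU : IsOpen U) (hUsub : U ⊆ Set.Ioi (0:ℝ) ×ˢ Set.Ioi (0:ℝ))
    (τ₀ η₀ : ℝ) (hmem : (τ₀, η₀) ∈ U)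
    (z : ℝ → ℝ → ℝ)
    (hzneg : ∀ p ∈ U, z (Prod.fst p) (Prod.snd p) < 0)
    (hz : ∀ p ∈ U, Prod.fst p =
      ∫ y in (0:ℝ)..(Prod.snd p), ξ y / (z (Prod.fst p) (Prod.snd p) - ξ y) ^ 2)
    (hdτ : DifferentiableAt ℝ (fun τ : ℝ => z τ η₀) τ₀)
    (hdη : DifferentiableAt ℝ (fun η : ℝ => z τ₀ η) η₀) :
    deriv (fun τ : ℝ => z τ η₀ / (z τ η₀ - ξ η₀)) τ₀ +
      deriv (fun η : ℝ =>
        ξ η * (z τ₀ η / (z τ₀ η - ξ η)) / (1 - z τ₀ η / (z τ₀ η - ξ η))) η₀ = 0 := by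
  have hne : ∀ w < 0, ∀ y, w - ξ y ≠ 0 := fun w hw y => by
    have := (hbd y).1
    linarith
  have hz₀ : z τ₀ η₀ < 0 := hzneg _ hmem
  have hUτ : ∀ᶠ τ in nhds τ₀, (τ, η₀) ∈ U :=
    ((by fun_prop : Continuous fun τ : ℝ => (τ, η₀)).tendsto τ₀).eventually (hU.mem_nhds hmem)
  have hUη : ∀ᶠ η in nhds η₀, (τ₀, η) ∈ U :=
    ((by fun_prop : Continuous fun η : ℝ => (τ₀, η)).tendsto η₀).eventually (hU.mem_nhds hmem)
  obtain ⟨D, hD⟩ : ∃ D, HasDerivAt (fun w : ℝ => ∫ y in (0:ℝ)..η₀, ξ y / (w - ξ y) ^ 2) D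
      (z τ₀ η₀) :=
    ⟨_, (differentiableAt_integral_div_sub_sq hcont hm hbd 0 η₀ hz₀).hasDerivAt⟩
  have hτ : D * deriv (fun τ : ℝ => z τ η₀) τ₀ = 1 := by
    refine (HasDerivAt.comp (h := fun τ => z τ η₀) τ₀ hD hdτ.hasDerivAt).unique ?_
    refine (hasDerivAt_id τ₀).congr_of_eventuallyEq ?_
    filter_upwards [hUτ] with τ hτ
    exact (hz _ hτ).symm
  have hint : ∀ w < 0, ∀ a b : ℝ,
      IntervalIntegrable (fun y => ξ y / (w - ξ y) ^ 2) volume a b := fun w hw a b =>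
    (hcont.div ((continuous_const.sub hcont).pow 2)
      fun y => pow_ne_zero 2 (hne w hw y)).intervalIntegrable _ _
  have hdiag := hasDerivAt_integral_diagonal (f := fun η y => ξ y / (z τ₀ η - ξ y) ^ 2) (a := η₀)
    (by
      have h1 : ContinuousAt (fun p : ℝ × ℝ => z τ₀ p.1) (η₀, η₀) :=
        ContinuousAt.comp (f := Prod.fst) (x := (η₀, η₀)) hdη.continuousAt continuousAt_fst
      have h2 : ContinuousAt (fun p : ℝ × ℝ => ξ p.2) (η₀, η₀) :=
        (hcont.comp continuous_snd).continuousAt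
      exact h2.div ((h1.sub h2).pow 2) (pow_ne_zero 2 (hne _ hz₀ _)))
    (by
      filter_upwards [hUη] with η hη
      exact hint _ (hzneg _ hη) _ _)
  have hη : D * deriv (fun η : ℝ => z τ₀ η) η₀ + ξ η₀ / (z τ₀ η₀ - ξ η₀) ^ 2 = 0 := by
    refine ((HasDerivAt.comp (h := fun η => z τ₀ η) η₀ hD hdη.hasDerivAt).add hdiag).unique ?_
    refine (hasDerivAt_const η₀ τ₀).congr_of_eventuallyEq ?_
    filter_upwards [hUη] with η hη
    have hw := hzneg _ hη
    exact (intervalIntegral.integral_add_adjacent_intervals (hint _ hw _ _)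
      (hint _ hw _ _)).trans (hz _ hη).symm
  have hflux : (fun η : ℝ =>
      ξ η * (z τ₀ η / (z τ₀ η - ξ η)) / (1 - z τ₀ η / (z τ₀ η - ξ η))) =ᶠ[nhds η₀]
      fun η => -z τ₀ η := by
    filter_upwards [hUη] with η hη
    have h1 := hne _ (hzneg _ hη) η
    have h2 : ξ η ≠ 0 := (hm.trans_le (hbd η).1).ne'
    have h3 : 1 - z τ₀ η / (z τ₀ η - ξ η) = -ξ η / (z τ₀ η - ξ η) := by
      field_simp
      ring
    simp only at h1
    rw [h3]
    field_simp
  have hρ := (hdτ.hasDerivAt.div (hdτ.hasDerivAt.sub_const (ξ η₀)) (hne _ hz₀ η₀)).deriv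
  rw [hflux.deriv_eq, deriv.fun_neg]
  refine (congrArg (· + _) hρ).trans ?_
  have hD0 : D ≠ 0 := left_ne_zero_of_mul_eq_one hτ
  have h1 := hne _ hz₀ η₀
  apply mul_left_cancel₀ hD0
  linear_combination (-(ξ η₀) / (z τ₀ η₀ - ξ η₀) ^ 2) * hτ - hη
end

section
/- Fix an integer N ≥ 1, reals ξ_1, …, ξ_N > 0, and a real t with 0 < t < ∑_{a=1}^N 1/ξ_a. Let z_L < 0 be the unique negative real with t = ∑_{a=1}^N ξ_a/(z_L − ξ_a)², and set h := ∑_{a=1}^N z_L²/(z_L − ξ_a)². Then: (i) z_L satisfies h/z_L = t + ∑_{a=1}^N 1/(z_L − ξ_a) and also h/z_L² = ∑_{a=1}^N 1/(z_L − ξ_a)² (so z_L is a double critical point of S_L); and (ii) every complex number z with z ≠ 0, z ≠ ξ_a for all a, and h/z = t + ∑_{a=1}^N 1/(z − ξ_a) is real, and either z = z_L or z > 0. -/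
/-- A zero of a Cauchy transform `∑ w_a / (z - ξ_a)` with positive weights and positive poles
is a positive real. -/
theorem im_eq_zero_and_re_pos_of_sum_div_sub_eq_zero {ι : Type*} [Fintype ι] [Nonempty ι]
    {w ξ : ι → ℝ} (hw : ∀ a, 0 < w a) (hξ : ∀ a, 0 < ξ a) {z : ℂ} (hz : ∀ a, z ≠ (ξ a : ℂ))
    (hsum : ∑ a, (w a : ℂ) / (z - (ξ a : ℂ)) = 0) : z.im = 0 ∧ 0 < z.re := by
  have hpos : ∀ a, 0 < w a / Complex.normSq (z - ξ a) := fun a =>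
    div_pos (hw a) (Complex.normSq_pos.2 (sub_ne_zero.2 (hz a)))
  have him := congrArg Complex.im hsum
  have hre := congrArg Complex.re hsum
  rw [Complex.im_sum] at him
  rw [Complex.re_sum] at hre
  have him' : ∀ a, ((w a : ℂ) / (z - (ξ a : ℂ))).im
      = -((w a / Complex.normSq (z - ξ a)) * z.im) := fun a => by
    simp [Complex.div_im]; ring
  have hre' : ∀ a, ((w a : ℂ) / (z - (ξ a : ℂ))).re
      = (w a / Complex.normSq (z - ξ a)) * (z.re - ξ a) := fun a => by
    simp [Complex.div_re]; ring
  simp only [him', hre', Complex.zero_im, Complex.zero_re] at him hre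
  constructor
  · rw [Finset.sum_neg_distrib, neg_eq_zero, ← Finset.sum_mul] at him
    exact (mul_eq_zero.1 him).resolve_left
      (Finset.sum_pos (fun a _ => hpos a) Finset.univ_nonempty).ne'
  · by_contra! hle
    refine (Finset.sum_neg (fun a _ => ?_) Finset.univ_nonempty).ne hre
    exact mul_neg_of_pos_of_neg (hpos a) (by linarith [hξ a])

/-- with `z_L < 0` the unique negative root of `t = ∑ ξ_a/(z − ξ_a)²` and
`h = ∑ z_L²/(z_L − ξ_a)²`: (i) `h/z_L = t + ∑ 1/(z_L − ξ_a)` and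
`h/z_L² = ∑ 1/(z_L − ξ_a)²` (so `z_L` is a double critical point of `S_L`); and (ii)
every complex critical point, i.e. every `z ≠ 0` with `z ≠ ξ_a` and
`h/z = t + ∑ 1/(z − ξ_a)`, is real, and is either `z_L` or positive. -/
theorem stmt_12 (N : ℕ) (hN : 1 ≤ N) (ξ : Fin N → ℝ) (hξ : ∀ a, 0 < ξ a)
    (t : ℝ) (ht : 0 < t) (hte : t < ∑ a, 1 / ξ a)
    (zL : ℝ) (hzL : zL < 0) (hroot : t = ∑ a, ξ a / (zL - ξ a) ^ 2)
    (h : ℝ) (hh : h = ∑ a, zL ^ 2 / (zL - ξ a) ^ 2) :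
    (h / zL = t + ∑ a, 1 / (zL - ξ a) ∧
      h / zL ^ 2 = ∑ a, 1 / (zL - ξ a) ^ 2) ∧
    ∀ z : ℂ, z ≠ 0 → (∀ a, z ≠ (ξ a : ℂ)) →
      (h : ℂ) / z = (t : ℂ) + ∑ a, 1 / (z - (ξ a : ℂ)) →
      z.im = 0 ∧ (z = (zL : ℂ) ∨ 0 < z.re) := by
  have hc : zL ≠ 0 := hzL.ne
  have hne : ∀ a, zL - ξ a ≠ 0 := fun a => (sub_neg.2 (hzL.trans (hξ a))).ne
  refine ⟨⟨?_, ?_⟩, ?_⟩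
  · rw [hh, hroot, Finset.sum_div, ← Finset.sum_add_distrib]
    refine Finset.sum_congr rfl fun a _ => ?_
    have := hne a
    field_simp
    ring
  · rw [hh, Finset.sum_div]
    refine Finset.sum_congr rfl fun a _ => ?_
    have := hne a
    field_simp
  · intro z hz hzξ hcrit
    by_cases hzc : z = (zL : ℂ)
    · exact ⟨by simp [hzc], Or.inl hzc⟩
    have : Nonempty (Fin N) := ⟨⟨0, hN⟩⟩
    have hfactor : (t : ℂ) + ∑ a, 1 / (z - (ξ a : ℂ)) - (h : ℂ) / z
        = (z - zL) ^ 2 / z * ∑ a, ((ξ a / (zL - ξ a) ^ 2 : ℝ) : ℂ) / (z - (ξ a : ℂ)) := by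
      rw [hroot, hh, Complex.ofReal_sum, Complex.ofReal_sum, Finset.sum_div, Finset.mul_sum,
        ← Finset.sum_add_distrib, ← Finset.sum_sub_distrib]
      refine Finset.sum_congr rfl fun a _ => ?_
      have h1 : (zL : ℂ) - ξ a ≠ 0 := by exact_mod_cast hne a
      have h2 : z - (ξ a : ℂ) ≠ 0 := sub_ne_zero.2 (hzξ a)
      push_cast
      field_simp
      ring
    rw [← hcrit, sub_self] at hfactor
    have hsum := (mul_eq_zero.1 hfactor.symm).resolve_left
      (div_ne_zero (pow_ne_zero 2 (sub_ne_zero.2 hzc)) hz)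
    have hw : ∀ a, 0 < ξ a / (zL - ξ a) ^ 2 := fun a =>
      div_pos (hξ a) (sq_pos_iff.2 (hne a))
    obtain ⟨him, hre⟩ := im_eq_zero_and_re_pos_of_sum_div_sub_eq_zero hw hξ hzξ hsum
    exact ⟨him, Or.inr hre⟩
end

section
/- Fix an integer N ≥ 1, reals ξ_1, …, ξ_N > 0, and a real z_L < 0. Set t := ∑_{a=1}^N ξ_a/(z_L − ξ_a)² and h := ∑_{a=1}^N z_L²/(z_L − ξ_a)². Define g : ℝ → ℝ by g(r) := t·z_L − (h/2)·log(z_L² + r²) + ∑_{a=1}^N (1/2)·log((ξ_a − z_L)² + r²). Then for every r ≠ 0 one has g(r) > g(0); that is, the real part of S_L along the vertical line z_L + iℝ attains its minimum uniquely at w = z_L. -/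
/-- Bernoulli's inequality in logarithmic form: `x ↦ x * log (1 + y / x)` is strictly increasing,
here compared at `A < B`. -/
theorem div_mul_log_add_sub_log_lt {A B x : ℝ} (hA : 0 < A) (hAB : A < B) (hx : 0 < x) :
    A / B * (Real.log (A + x) - Real.log A) < Real.log (B + x) - Real.log B := by
  have hB : 0 < B := hA.trans hAB
  have hxA : 0 < x / A := div_pos hx hA
  have bernoulli : (1 + x / A) ^ (A / B) < 1 + A / B * (x / A) :=
    rpow_one_add_lt_one_add_mul_self (by linarith) hxA.ne' (div_pos hA hB)
      ((div_lt_one hB).2 hAB)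
  have hlog := Real.log_lt_log (by positivity) bernoulli
  rw [Real.log_rpow (by positivity)] at hlog
  rw [← Real.log_div (by positivity) hA.ne', ← Real.log_div (by positivity) hB.ne']
  have h₁ : (A + x) / A = 1 + x / A := by field_simp
  have h₂ : (B + x) / B = 1 + A / B * (x / A) := by field_simp
  rwa [h₁, h₂]

/-- with `t = ∑ ξ_a/(z_L − ξ_a)²` and `h = ∑ z_L²/(z_L − ξ_a)²`, the real
part of `S_L` along the vertical line `z_L + iℝ`, i.e.
`g(r) = t z_L − (h/2) log(z_L² + r²) + ∑ (1/2) log((ξ_a − z_L)² + r²)`,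
attains its minimum uniquely at `r = 0` (i.e. at `w = z_L`). -/
theorem stmt_14 (N : ℕ) (hN : 1 ≤ N) (ξ : Fin N → ℝ) (hξ : ∀ a, 0 < ξ a)
    (zL : ℝ) (hzL : zL < 0)
    (t h : ℝ) (ht : t = ∑ a, ξ a / (zL - ξ a) ^ 2)
    (hh : h = ∑ a, zL ^ 2 / (zL - ξ a) ^ 2)
    (g : ℝ → ℝ)
    (hg : g = fun r : ℝ => t * zL - (h / 2) * Real.log (zL ^ 2 + r ^ 2) +
      ∑ a, (1 / 2) * Real.log ((ξ a - zL) ^ 2 + r ^ 2)) :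
    ∀ r : ℝ, r ≠ 0 → g 0 < g r := by
  intro r hr
  have hr2 : 0 < r ^ 2 := by positivity
  have hterm : ∀ a, zL ^ 2 / (zL - ξ a) ^ 2 * (Real.log (zL ^ 2 + r ^ 2) - Real.log (zL ^ 2)) <
      Real.log ((ξ a - zL) ^ 2 + r ^ 2) - Real.log ((ξ a - zL) ^ 2) := by
    intro a
    have hlt : zL ^ 2 < (ξ a - zL) ^ 2 := by nlinarith [hξ a, mul_pos (hξ a) (neg_pos.2 hzL)]
    rw [sub_sq_comm zL]
    exact div_mul_log_add_sub_log_lt (by nlinarith) hlt hr2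
  have hsum := Finset.sum_lt_sum_of_nonempty (s := Finset.univ) ⟨⟨0, hN⟩, Finset.mem_univ _⟩
    fun a _ => hterm a
  rw [← Finset.sum_mul, ← hh, Finset.sum_sub_distrib] at hsum
  simp only [hg, ← Finset.mul_sum, ne_eq, OfNat.ofNat_ne_zero, not_false_eq_true, zero_pow,
    add_zero]
  linarith
end

section
/- Fix reals ξ > 0 and z_L < 0, and define f : ℝ → ℝ by f(φ) := (ξ z_L cos φ)/(z_L − ξ)² − (z_L² log(−z_L))/(z_L − ξ)² + (1/2)·log(ξ² + z_L² − 2 z_L ξ cos φ). Then the first, second, and third derivatives of f at φ = 0 all vanish, and the fourth derivative of f at φ = 0 equals −6 z_L² ξ²/(z_L − ξ)⁴, which is strictly negative. -/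
/-- The Leibniz rule for a factor vanishing to order three. -/
theorem iteratedDeriv_mul_of_eq_zero {h w : ℝ → ℝ} {x : ℝ} (hh : ContDiffAt ℝ 3 h x)
    (hw : ContDiffAt ℝ 3 w x) (h0 : h x = 0) (h1 : iteratedDeriv 1 h x = 0)
    (h2 : iteratedDeriv 2 h x = 0) :
    iteratedDeriv 1 (h * w) x = 0 ∧ iteratedDeriv 2 (h * w) x = 0 ∧
      iteratedDeriv 3 (h * w) x = iteratedDeriv 3 h x * w x := by
  refine ⟨?_, ?_, ?_⟩ <;>
    rw [iteratedDeriv_mul (hh.of_le (by norm_num))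
      (hw.of_le (by norm_num))] <;>
    simp [Finset.sum_range_succ, -iteratedDeriv_one, h0, h1, h2]

theorem deriv_sin_mul_cos_sub_one :
    deriv (fun x : ℝ => Real.sin x * (Real.cos x - 1)) =
      fun x => 2 * Real.cos x ^ 2 - Real.cos x - 1 := by
  funext x
  refine (((Real.hasDerivAt_sin x).mul ((Real.hasDerivAt_cos x).sub_const 1)).congr_deriv
    ?_).deriv
  linear_combination -Real.sin_sq_add_cos_sq x

theorem deriv_two_mul_cos_sq_sub_cos_sub_one :
    deriv (fun x : ℝ => 2 * Real.cos x ^ 2 - Real.cos x - 1) =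
      fun x => Real.sin x * (1 - 4 * Real.cos x) := by
  funext x
  have hc := Real.hasDerivAt_cos x
  refine (((((hc.pow 2).const_mul 2).sub hc).sub_const 1).congr_deriv ?_).deriv
  ring

theorem deriv_sin_mul_one_sub_four_mul_cos_zero :
    deriv (fun x : ℝ => Real.sin x * (1 - 4 * Real.cos x)) 0 = -3 := by
  refine (((Real.hasDerivAt_sin 0).mul
    (((Real.hasDerivAt_cos 0).const_mul 4).const_sub 1)).congr_deriv ?_).deriv
  norm_num

/-- for `ξ > 0`, `z_L < 0` and
`f(φ) = ξ z_L cos φ/(z_L − ξ)² − z_L² log(−z_L)/(z_L − ξ)²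
        + (1/2) log(ξ² + z_L² − 2 z_L ξ cos φ)`
(the real part of the single-`ξ` summand of `S_L` along the circle `|z| = −z_L`),
the first three derivatives of `f` at `0` vanish, and the fourth derivative at `0`
equals `−6 z_L² ξ²/(z_L − ξ)⁴ < 0`. -/
theorem stmt_15 (ξ zL : ℝ) (hξ : 0 < ξ) (hzL : zL < 0)
    (f : ℝ → ℝ)
    (hf : f = fun φ : ℝ => ξ * zL * Real.cos φ / (zL - ξ) ^ 2
      - zL ^ 2 * Real.log (-zL) / (zL - ξ) ^ 2
      + (1 / 2) * Real.log (ξ ^ 2 + zL ^ 2 - 2 * zL * ξ * Real.cos φ)) :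
    iteratedDeriv 1 f 0 = 0 ∧ iteratedDeriv 2 f 0 = 0 ∧ iteratedDeriv 3 f 0 = 0 ∧
    iteratedDeriv 4 f 0 = -6 * zL ^ 2 * ξ ^ 2 / (zL - ξ) ^ 4 ∧
    iteratedDeriv 4 f 0 < 0 := by
  have hne : zL - ξ ≠ 0 := by linarith
  set D : ℝ → ℝ := fun x => ξ ^ 2 + zL ^ 2 - 2 * zL * ξ * Real.cos x with hD
  set h : ℝ → ℝ := fun x => Real.sin x * (Real.cos x - 1) with hh
  set w : ℝ → ℝ := fun x => 2 * (zL * ξ) ^ 2 / (zL - ξ) ^ 2 * (D x)⁻¹ with hw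
  have hD0 : D 0 = (zL - ξ) ^ 2 := by
    simp only [hD, Real.cos_zero]
    ring
  have hDsmooth : ContDiff ℝ 3 D := by fun_prop
  have hD0ne : D 0 ≠ 0 := by
    rw [hD0]
    positivity
  have hderiv : deriv f =ᶠ[nhds 0] h * w := by
    filter_upwards [hDsmooth.continuous.continuousAt.eventually_ne hD0ne] with x hx
    have hDx : HasDerivAt D (2 * zL * ξ * Real.sin x) x :=
      (((Real.hasDerivAt_cos x).const_mul (2 * zL * ξ)).const_sub (ξ ^ 2 + zL ^ 2)).congr_deriv
        (by ring)
    rw [hf]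
    refine (((((Real.hasDerivAt_cos x).const_mul (ξ * zL)).div_const ((zL - ξ) ^ 2)).sub_const
      (zL ^ 2 * Real.log (-zL) / (zL - ξ) ^ 2)).add
      ((hDx.log hx).const_mul (1 / 2))).congr_deriv ?_ |>.deriv
    simp only [Pi.mul_apply, hh, hw]
    field_simp
    simp only [hD]
    ring
  have hwsmooth : ContDiffAt ℝ 3 w 0 := contDiffAt_const.mul (hDsmooth.contDiffAt.inv hD0ne)
  have hhsmooth : ContDiffAt ℝ 3 h 0 := by fun_prop
  have hh3 : iteratedDeriv 3 h 0 = -3 := by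
    rw [iteratedDeriv_succ', iteratedDeriv_succ', deriv_sin_mul_cos_sub_one,
      deriv_two_mul_cos_sq_sub_cos_sub_one, iteratedDeriv_one,
      deriv_sin_mul_one_sub_four_mul_cos_zero]
  have hh2 : iteratedDeriv 2 h 0 = 0 := by
    rw [iteratedDeriv_succ', deriv_sin_mul_cos_sub_one, iteratedDeriv_one,
      deriv_two_mul_cos_sq_sub_cos_sub_one]
    simp
  have hh1 : iteratedDeriv 1 h 0 = 0 := by
    rw [iteratedDeriv_one, deriv_sin_mul_cos_sub_one]
    norm_num
  have hh0 : h 0 = 0 := by simp [hh]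
  obtain ⟨h1, h2, h3⟩ := iteratedDeriv_mul_of_eq_zero hhsmooth hwsmooth hh0 hh1 hh2
  have h4 : iteratedDeriv 4 f 0 = -6 * zL ^ 2 * ξ ^ 2 / (zL - ξ) ^ 4 := by
    rw [iteratedDeriv_succ', hderiv.iteratedDeriv_eq, h3, hh3]
    simp only [hw, hD0]
    field_simp
    ring
  refine ⟨?_, ?_, ?_, h4, ?_⟩
  · rw [iteratedDeriv_one, hderiv.eq_of_nhds, Pi.mul_apply, hh0, zero_mul]
  · rw [iteratedDeriv_succ', hderiv.iteratedDeriv_eq, h1]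
  · rw [iteratedDeriv_succ', hderiv.iteratedDeriv_eq, h2]
  · rw [h4]
    have hz : 0 < zL ^ 2 := sq_pos_of_neg hzL
    have hpos : 0 < (zL - ξ) ^ 4 := by positivity
    exact div_neg_of_neg_of_pos (by nlinarith [mul_pos hz (pow_pos hξ 2)]) hpos
end

section
/- Fix reals ξ > 0 and z_L < 0, and define g : ℝ → ℝ by g(r) := (ξ z_L)/(z_L − ξ)² − (z_L²/(2 (z_L − ξ)²))·log(z_L² + r²) + (1/2)·log((ξ − z_L)² + r²). Then the first, second, and third derivatives of g at r = 0 all vanish, and the fourth derivative of g at r = 0 is strictly positive. -/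
theorem hasDerivAt_log_add_sq {c : ℝ} (hc : 0 < c) (r : ℝ) :
    HasDerivAt (fun x : ℝ => Real.log (c + x ^ 2)) (2 * r / (c + r ^ 2)) r := by
  have h : HasDerivAt (fun x : ℝ => c + x ^ 2) (2 * r) r := by
    simpa using (hasDerivAt_pow 2 r).const_add c
  exact h.log (by positivity)

/-- Derivative of a quotient by a power of `c + x ^ 2`. -/
theorem HasDerivAt.div_add_sq_pow {c : ℝ} (hc : 0 < c) {p : ℝ → ℝ} {p' r : ℝ}
    (hp : HasDerivAt p p' r) (n : ℕ) :
    HasDerivAt (fun x : ℝ => p x / (c + x ^ 2) ^ (n + 1))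
      ((p' * (c + r ^ 2) - 2 * (n + 1) * r * p r) / (c + r ^ 2) ^ (n + 2)) r := by
  have h : HasDerivAt (fun x : ℝ => c + x ^ 2) (2 * r) r := by
    simpa using (hasDerivAt_pow 2 r).const_add c
  have hne : c + r ^ 2 ≠ 0 := by positivity
  refine (hp.fun_div (h.fun_pow (n + 1)) (pow_ne_zero _ hne)).congr_deriv ?_
  simp only [Nat.add_sub_cancel, Nat.cast_add, Nat.cast_one]
  field_simp
  ring

theorem hasDerivAt_div_add_sq {c : ℝ} (hc : 0 < c) (r : ℝ) :
    HasDerivAt (fun x : ℝ => 2 * x / (c + x ^ 2))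
      ((2 * c - 2 * r ^ 2) / (c + r ^ 2) ^ 2) r := by
  have h := ((hasDerivAt_id r).const_mul 2).div_add_sq_pow hc 0
  simp only [id, zero_add, pow_one] at h
  refine h.congr_deriv ?_
  push_cast
  ring

theorem hasDerivAt_sub_div_add_sq_sq {c : ℝ} (hc : 0 < c) (r : ℝ) :
    HasDerivAt (fun x : ℝ => (2 * c - 2 * x ^ 2) / (c + x ^ 2) ^ 2)
      ((4 * r ^ 3 - 12 * c * r) / (c + r ^ 2) ^ 3) r := by
  refine ((((hasDerivAt_pow 2 r).const_mul 2).const_sub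
    (2 * c)).div_add_sq_pow hc 1).congr_deriv ?_
  push_cast
  ring

theorem hasDerivAt_sub_div_add_sq_cube {c : ℝ} (hc : 0 < c) (r : ℝ) :
    HasDerivAt (fun x : ℝ => (4 * x ^ 3 - 12 * c * x) / (c + x ^ 2) ^ 3)
      ((72 * c * r ^ 2 - 12 * c ^ 2 - 12 * r ^ 4) / (c + r ^ 2) ^ 4) r := by
  refine ((((hasDerivAt_pow 3 r).const_mul 4).sub
    ((hasDerivAt_id r).const_mul (12 * c))).div_add_sq_pow hc 2).congr_deriv ?_
  simp only [Pi.sub_apply, id]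
  push_cast
  ring

/-- for `ξ > 0`, `z_L < 0` and
`g(r) = ξ z_L/(z_L − ξ)² − (z_L²/(2(z_L − ξ)²)) log(z_L² + r²)
        + (1/2) log((ξ − z_L)² + r²)`
(the real part of the single-`ξ` summand of `S_L` along the vertical line `z_L + iℝ`),
the first three derivatives of `g` at `0` vanish, and the fourth derivative at `0`
is strictly positive. -/
theorem stmt_17 (ξ zL : ℝ) (hξ : 0 < ξ) (hzL : zL < 0)
    (g : ℝ → ℝ)
    (hg : g = fun r : ℝ => ξ * zL / (zL - ξ) ^ 2
      - (zL ^ 2 / (2 * (zL - ξ) ^ 2)) * Real.log (zL ^ 2 + r ^ 2)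
      + (1 / 2) * Real.log ((ξ - zL) ^ 2 + r ^ 2)) :
    iteratedDeriv 1 g 0 = 0 ∧ iteratedDeriv 2 g 0 = 0 ∧ iteratedDeriv 3 g 0 = 0 ∧
    0 < iteratedDeriv 4 g 0 := by
  have hz : 0 < zL ^ 2 := sq_pos_of_neg hzL
  have hd : 0 < ξ - zL := by linarith
  have hb : 0 < (ξ - zL) ^ 2 := by positivity
  have hab : zL ^ 2 < (ξ - zL) ^ 2 := by nlinarith
  have hsq : (zL - ξ) ^ 2 = (ξ - zL) ^ 2 := by ring
  rw [hsq] at hg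
  set a := zL ^ 2
  set b := (ξ - zL) ^ 2
  have h1 : deriv g = fun r => -(a / (2 * b) * (2 * r / (a + r ^ 2)))
      + 1 / 2 * (2 * r / (b + r ^ 2)) := by
    rw [hg]
    exact deriv_eq fun r => (((hasDerivAt_log_add_sq hz r).const_mul _).const_sub _).add
      ((hasDerivAt_log_add_sq hb r).const_mul _)
  have h2 : deriv (deriv g) = fun r => -(a / (2 * b) * ((2 * a - 2 * r ^ 2) / (a + r ^ 2) ^ 2))
      + 1 / 2 * ((2 * b - 2 * r ^ 2) / (b + r ^ 2) ^ 2) := by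
    rw [h1]
    exact deriv_eq fun r => ((hasDerivAt_div_add_sq hz r).const_mul _).neg.add
      ((hasDerivAt_div_add_sq hb r).const_mul _)
  have h3 : deriv (deriv (deriv g)) = fun r =>
      -(a / (2 * b) * ((4 * r ^ 3 - 12 * a * r) / (a + r ^ 2) ^ 3))
      + 1 / 2 * ((4 * r ^ 3 - 12 * b * r) / (b + r ^ 2) ^ 3) := by
    rw [h2]
    exact deriv_eq fun r => ((hasDerivAt_sub_div_add_sq_sq hz r).const_mul _).neg.add
      ((hasDerivAt_sub_div_add_sq_sq hb r).const_mul _)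
  have h4 : deriv (deriv (deriv (deriv g))) = fun r =>
      -(a / (2 * b) * ((72 * a * r ^ 2 - 12 * a ^ 2 - 12 * r ^ 4) / (a + r ^ 2) ^ 4))
      + 1 / 2 * ((72 * b * r ^ 2 - 12 * b ^ 2 - 12 * r ^ 4) / (b + r ^ 2) ^ 4) := by
    rw [h3]
    exact deriv_eq fun r => ((hasDerivAt_sub_div_add_sq_cube hz r).const_mul _).neg.add
      ((hasDerivAt_sub_div_add_sq_cube hb r).const_mul _)
  simp only [iteratedDeriv_eq_iterate, Function.iterate_succ, Function.iterate_zero,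
    Function.comp_apply, id]
  rw [h4, h3, h2, h1]
  refine ⟨by simp, ?_, by simp, ?_⟩
  · field_simp
    ring
  · have key : -(a / (2 * b) * ((72 * a * (0 : ℝ) ^ 2 - 12 * a ^ 2 - 12 * 0 ^ 4) / (a + 0 ^ 2) ^ 4))
        + 1 / 2 * ((72 * b * 0 ^ 2 - 12 * b ^ 2 - 12 * 0 ^ 4) / (b + 0 ^ 2) ^ 4)
        = 6 * (b - a) / (a * b ^ 2) := by
      field_simp
      ring
    simp only [key]
    have : 0 < b - a := sub_pos.mpr hab
    positivity
end

section
/- Let μ be a Young diagram. Consider the two subsets of ℤ: A := { μ_j − j : j ∈ ℤ_{≥1} } (where μ_j is the length of the j-th row, equal to 0 for j greater than the number of rows) and B := { −μ′_i + i − 1 : i ∈ ℤ_{≥1} } (where μ′_i is the length of the i-th column, equal to 0 for i greater than the number of columns). Then B is exactly the complement of A in ℤ: A ∩ B = ∅ and A ∪ B = ℤ. (In 0-indexed terms: the sets { rowLen(μ, k) − (k+1) : k ∈ ℕ } and { k − colLen(μ, k) : k ∈ ℕ } partition ℤ.) -/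
namespace YoungDiagram

/-- No row coordinate of a Young diagram is a column coordinate. -/
theorem rowLen_add_colLen_ne (μ : YoungDiagram) (i j : ℕ) :
    μ.rowLen i + μ.colLen j ≠ i + j + 1 := by
  have h : j < μ.rowLen i ↔ i < μ.colLen j := mem_iff_lt_rowLen.symm.trans mem_iff_lt_colLen
  omega

/-- Every diagonal leaves a Young diagram: there is a first cell of the diagonal starting at
`(a, b)` that is not in the diagram. -/
theorem exists_notMem_diagonal (μ : YoungDiagram) (a b : ℕ) : ∃ n, (n + a, n + b) ∉ μ := by
  refine ⟨μ.rowLen 0, fun h => ?_⟩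
  have h₁ := mem_iff_lt_rowLen.1 h
  have h₂ := μ.rowLen_anti 0 (μ.rowLen 0 + a) (Nat.zero_le _)
  omega

/-- Every integer is a row coordinate or a column coordinate of a Young diagram. -/
theorem exists_rowLen_or_exists_colLen (μ : YoungDiagram) (x : ℤ) :
    (∃ k : ℕ, x = (μ.rowLen k : ℤ) - (k + 1)) ∨ ∃ k : ℕ, x = (k : ℤ) - (μ.colLen k : ℤ) := by
  classical
  have hex := μ.exists_notMem_diagonal (-x).toNat x.toNat
  obtain ⟨n, hn, hmin⟩ : ∃ n, (n + (-x).toNat, n + x.toNat) ∉ μ ∧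
      ∀ m < n, (m + (-x).toNat, m + x.toNat) ∈ μ :=
    ⟨Nat.find hex, Nat.find_spec hex, fun m hm => not_not.1 (Nat.find_min hex hm)⟩
  obtain ⟨i, hi⟩ : ∃ i, i = n + (-x).toNat := ⟨_, rfl⟩
  obtain ⟨j, hj⟩ : ∃ j, j = n + x.toNat := ⟨_, rfl⟩
  rw [← hi, ← hj, mem_iff_lt_colLen] at hn
  by_cases hc : μ.colLen j = i
  · exact Or.inr ⟨j, by omega⟩
  · refine Or.inl ⟨i - 1, ?_⟩
    have hle : ¬ j < μ.rowLen (i - 1) := by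
      rw [← mem_iff_lt_rowLen, mem_iff_lt_colLen]
      omega
    have hge : j ≤ μ.rowLen (i - 1) := by
      rcases Nat.eq_zero_or_pos n with rfl | hpos
      · omega
      · have h := mem_iff_lt_rowLen.1 (hmin (n - 1) (by omega))
        rw [show n - 1 + (-x).toNat = i - 1 by omega] at h
        omega
    omega

end YoungDiagram

/-- for a Young diagram `μ`, the configurations
`A = {μ_j − j : j ≥ 1}` (row coordinates) and `B = {−μ′_i + i − 1 : i ≥ 1}`
(column coordinates) partition `ℤ`: `B` is exactly the complement of `A`.
In 0-indexed terms, `{rowLen μ k − (k+1) : k ∈ ℕ}` and `{k − colLen μ k : k ∈ ℕ}`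
are disjoint and their union is all of `ℤ`. -/
theorem stmt_18 (μ : YoungDiagram) :
    ({x : ℤ | ∃ k : ℕ, x = (μ.rowLen k : ℤ) - (k + 1)} ∩
        {x : ℤ | ∃ k : ℕ, x = (k : ℤ) - (μ.colLen k : ℤ)} = ∅) ∧
    ({x : ℤ | ∃ k : ℕ, x = (μ.rowLen k : ℤ) - (k + 1)} ∪
        {x : ℤ | ∃ k : ℕ, x = (k : ℤ) - (μ.colLen k : ℤ)} = Set.univ) := by
  refine ⟨Set.eq_empty_iff_forall_notMem.2 ?_, Set.eq_univ_iff_forall.2 fun x => ?_⟩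
  · rintro x ⟨⟨i, hi⟩, j, hj⟩
    have := μ.rowLen_add_colLen_ne i j
    omega
  · exact μ.exists_rowLen_or_exists_colLen x
end
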